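/- Let q > 3 be a power of an odd prime, let m > 2 be an integer, n = (q^m−1)/2, and let a be an integer with 1 ≤ a < (q−1)/2. Set δ̃′ = a·q^{m−1} − 1 and δ = ⌈(δ̃′+1)/2⌉. Then the negacyclic BCH code C_{(n,−1,δ,0)} over F_q has length n, minimum distance at least δ, and dimension k = Σ_{j=0}^{⌊(m−1)/2⌋} binom(m, 2j+1) · ⌈(q−a−1)/2⌉^{2j+1} · ⌊(q−a+1)/2⌋^{m−2j−1} + κ·m, where κ = 1 if a is even and κ = 0 if a is odd. -/

import Mathlib

open Finset

/-- The `q`-cyclotomic coset of `i` modulo `N`, as a subset of `ZMod N`. -/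
def qCoset (q N i : ℕ) : Set (ZMod N) :=
  Set.range fun j : ℕ => (i : ZMod N) * (q : ZMod N) ^ j

/-- The odd `q`-cyclotomic coset leaders modulo `N`. -/
noncomputable def oddLeaders (q N : ℕ) : Finset ℕ := by
  classical
  exact (Finset.range N).filter fun s => Odd s ∧ ∀ j : ℕ, s ≤ (s * q ^ j) % N

/-- `x` is the `i`-th largest element of the finite set `S` (1-indexed). -/
def IsIthLargest (S : Finset ℕ) (i x : ℕ) : Prop :=
  x ∈ S ∧ (S.filter fun y => x ≤ y).card = i

/-- Evaluation of the polynomial with coefficient vector `c` at the point `x`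
of an extension field. -/
noncomputable def evalAt (F : Type*) {E : Type*} [Field F] [Field E] [Algebra F E]
    (n : ℕ) (x : E) : (Fin n → F) →ₗ[F] E where
  toFun c := ∑ j : Fin n, c j • x ^ (j : ℕ)
  map_add' a b := by simp [add_smul, Finset.sum_add_distrib]
  map_smul' r a := by simp [Finset.smul_sum, smul_smul]

/-- The negacyclic BCH code `C_(n,-1,δ,b)`: all words whose polynomial vanishes at
`γ^(1+2i)` for `b ≤ i ≤ b+δ-2`, where `γ` is a primitive `2n`-th root of unity. -/
noncomputable def negaBCH (F : Type*) {E : Type*} [Field F] [Field E] [Algebra F E]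
    (n : ℕ) (γ : E) (δ b : ℕ) : Submodule F (Fin n → F) :=
  ⨅ i ∈ Finset.Icc b (b + δ - 2), LinearMap.ker (evalAt F n (γ ^ (1 + 2 * i)))

/-- The cyclic BCH code `C_(n,1,δ,b)`: all words whose polynomial vanishes at
`β^i` for `b ≤ i ≤ b+δ-2`, where `β` is a primitive `n`-th root of unity. -/
noncomputable def cyclicBCH (F : Type*) {E : Type*} [Field F] [Field E] [Algebra F E]
    (n : ℕ) (β : E) (δ b : ℕ) : Submodule F (Fin n → F) :=
  ⨅ i ∈ Finset.Icc b (b + δ - 2), LinearMap.ker (evalAt F n (β ^ i))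

/-- The dual code under the standard inner product. -/
def dualCode {F : Type*} [Field F] {n : ℕ} (C : Submodule F (Fin n → F)) :
    Submodule F (Fin n → F) where
  carrier := {y | ∀ c ∈ C, ∑ j, y j * c j = 0}
  add_mem' := by
    intro a b ha hb c hc
    simp only [Set.mem_setOf_eq] at *
    simp [Pi.add_apply, add_mul, Finset.sum_add_distrib, ha c hc, hb c hc]
  zero_mem' := by intro c hc; simp
  smul_mem' := by
    intro r y hy c hc
    simp only [Set.mem_setOf_eq] at *
    simp [Pi.smul_apply, smul_eq_mul, mul_assoc, ← Finset.mul_sum, hy c hc]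

/-- The extended code of a code of length `n`. -/
def extendedCode {F : Type*} [Field F] {n : ℕ} (C : Submodule F (Fin n → F)) :
    Submodule F (Fin (n + 1) → F) where
  carrier := {x | (fun j : Fin n => x j.castSucc) ∈ C ∧ ∑ i, x i = 0}
  add_mem' := by
    intro a b ha hb
    exact ⟨C.add_mem ha.1 hb.1, by simp [Finset.sum_add_distrib, ha.2, hb.2]⟩
  zero_mem' := ⟨C.zero_mem, by simp⟩
  smul_mem' := by
    intro r x hx
    exact ⟨C.smul_mem r hx.1, by simp [← Finset.mul_sum, hx.2]⟩

/-- Hamming weight of a word. -/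
noncomputable def hWt {F : Type*} [Field F] {n : ℕ} (c : Fin n → F) : ℕ := by
  classical exact hammingNorm c

/-- `d` is the minimum Hamming distance of the code `C`. -/
def minDistIs {F : Type*} [Field F] {n : ℕ} (C : Submodule F (Fin n → F)) (d : ℕ) : Prop :=
  IsLeast {w : ℕ | ∃ c ∈ C, c ≠ 0 ∧ hWt c = w} d

section FieldLemmas

open Polynomial

variable {F E : Type*} [Field F] [Field E] [Algebra F E]

lemma evalAt_apply (n : ℕ) (x : E) (c : Fin n → F) :
    evalAt F n x c = ∑ j : Fin n, c j • x ^ (j : ℕ) := rfl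

lemma evalAt_coeff {n : ℕ} (x : E) {p : F[X]} (hp : p ∈ degreeLT F n) :
    evalAt F n x (fun i => p.coeff i) = aeval x p := by
  rw [evalAt_apply, aeval_def, eval₂_eq_sum_range' (algebraMap F E) (n := n + 1)
    (Nat.lt_succ_of_le (natDegree_le_of_degree_le (mem_degreeLT.1 hp).le)), Finset.sum_range_succ,
    coeff_eq_zero_of_degree_lt (mem_degreeLT.1 hp), ← Fin.sum_univ_eq_sum_range
    (fun i => algebraMap F E (p.coeff i) * x ^ i)]
  simp [Algebra.smul_def]

lemma evalAt_pow_card [Fintype F] (n : ℕ) (x : E) (c : Fin n → F) :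
    evalAt F n (x ^ Fintype.card F) c = evalAt F n x c ^ Fintype.card F := by
  change _ = FiniteField.frobeniusAlgHom F E (evalAt F n x c)
  simp only [evalAt_apply, map_sum, map_smul, map_pow, FiniteField.coe_frobeniusAlgHom]

lemma evalAt_pow_card_pow [Fintype F] (n : ℕ) (x : E) (c : Fin n → F) (j : ℕ) :
    evalAt F n (x ^ Fintype.card F ^ j) c = evalAt F n x c ^ Fintype.card F ^ j := by
  induction j with
  | zero => simp
  | succ j ih => rw [pow_succ, pow_mul, evalAt_pow_card, ih, pow_mul]

lemma mem_range_algebraMap_of_pow_card_eq [Fintype F] {x : E} (hx : x ^ Fintype.card F = x) :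
    x ∈ Set.range (algebraMap F E) := by
  have h0 : (X ^ Fintype.card F - X : F[X]) ≠ 0 :=
    FiniteField.X_pow_card_sub_X_ne_zero F Fintype.one_lt_card
  have hs : (X ^ Fintype.card F - X : F[X]).Splits := by
    rw [splits_iff_card_roots, FiniteField.roots_X_pow_card_sub_X,
      FiniteField.X_pow_card_sub_X_natDegree_eq F Fintype.one_lt_card]
    rfl
  exact hs.mem_range_of_isRoot h0 (by simp [hx])

lemma exists_map_eq_prod_X_sub_C [Fintype F] (S : Finset E)
    (hS : ∀ x ∈ S, x ^ Fintype.card F ∈ S) :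
    ∃ g : F[X], g.Monic ∧ g.map (algebraMap F E) = ∏ s ∈ S, (X - C s) := by
  classical
  set φ := (FiniteField.frobeniusAlgHom F E : E →+* E)
  have hφ : ∀ x, φ x = x ^ Fintype.card F := fun x => rfl
  have himg : S.image φ = S := by
    refine Finset.eq_of_subset_of_card_le (fun y hy => ?_) ?_
    · obtain ⟨x, hx, rfl⟩ := Finset.mem_image.1 hy
      exact hS x hx
    · rw [Finset.card_image_of_injective _ φ.injective]
  have hmap : (∏ s ∈ S, (X - C s)).map φ = ∏ s ∈ S, (X - C s) := by
    conv_rhs => rw [← himg]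
    rw [Finset.prod_image φ.injective.injOn, Polynomial.map_prod]
    simp
  have hl : (∏ s ∈ S, (X - C s)) ∈ lifts (algebraMap F E) := by
    rw [lifts_iff_coeff_lifts]
    intro i
    refine mem_range_algebraMap_of_pow_card_eq ?_
    conv_rhs => rw [← hmap]
    rw [coeff_map, hφ]
  obtain ⟨g, hg, -, hm⟩ := lifts_and_degree_eq_and_monic hl (monic_prod_X_sub_C _ _)
  exact ⟨g, hm, hg⟩

lemma finrank_iInf_ker_evalAt [Fintype F] (S : Finset E)
    (hS : ∀ x ∈ S, x ^ Fintype.card F ∈ S) {n : ℕ} (hn : S.card ≤ n) :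
    Module.finrank F (⨅ x ∈ S, LinearMap.ker (evalAt F n x) : Submodule F (Fin n → F)) =
      n - S.card := by
  obtain ⟨g, hgm, hg⟩ := exists_map_eq_prod_X_sub_C (F := F) S hS
  have hdeg : g.degree = S.card := by
    rw [← degree_map g (algebraMap F E), hg]
    simp [degree_prod]
  have hdvd : ∀ p : F[X], (∀ x ∈ S, aeval x p = 0) ↔ g ∣ p := by
    intro p
    rw [← map_dvd_map' (algebraMap F E), hg]
    constructor
    · intro h
      refine Finset.prod_dvd_of_coprime
        (fun a _ b _ hab => pairwise_coprime_X_sub_C Function.injective_id hab) fun x hx => ?_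
      rw [dvd_iff_isRoot, IsRoot, eval_map_algebraMap]
      exact h x hx
    · intro h x hx
      have := (Finset.dvd_prod_of_mem (fun s => X - C s) hx).trans h
      rwa [dvd_iff_isRoot, IsRoot, eval_map_algebraMap] at this
  have hmul : ∀ p : F[X], p ∈ degreeLT F (n - S.card) ↔ g * p ∈ degreeLT F n := by
    intro p
    rw [mem_degreeLT, mem_degreeLT, degree_mul, hdeg]
    rcases eq_or_ne p 0 with rfl | hp
    · simp
    · rw [degree_eq_natDegree hp]
      norm_cast
      omega
  let f : degreeLT F (n - S.card) →ₗ[F] (Fin n → F) :=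
    (degreeLTEquiv F n).toLinearMap ∘ₗ
      ((LinearMap.mulLeft F g).restrict fun p hp => (hmul p).1 hp)
  have hf : Function.Injective f := by
    refine (degreeLTEquiv F n).injective.comp fun p r h => Subtype.ext ?_
    have := congrArg Subtype.val h
    exact mul_left_cancel₀ hgm.ne_zero this
  have hrange : LinearMap.range f = ⨅ x ∈ S, LinearMap.ker (evalAt F n x) := by
    ext c
    simp only [LinearMap.mem_range, Submodule.mem_iInf, LinearMap.mem_ker]
    obtain ⟨⟨r, hr⟩, rfl⟩ := (degreeLTEquiv F n).surjective c
    have hc : ∀ x : E, evalAt F n x (degreeLTEquiv F n ⟨r, hr⟩) = aeval x r :=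
      fun x => evalAt_coeff x hr
    simp only [hc, hdvd]
    constructor
    · rintro ⟨p, hp⟩
      have := congrArg Subtype.val ((degreeLTEquiv F n).injective hp)
      exact ⟨p, this.symm⟩
    · rintro ⟨p, rfl⟩
      exact ⟨⟨p, (hmul p).2 hr⟩, rfl⟩
  rw [← hrange, LinearMap.finrank_range_of_inj hf, (degreeLTEquiv F _).finrank_eq]
  simp

lemma le_hWt_of_mem_negaBCH {n δ : ℕ} (hn : n ≠ 0) (hδ : 2 ≤ δ) {γ : E}
    (hγ : IsPrimitiveRoot γ (2 * n)) {c : Fin n → F} (hc : c ∈ negaBCH F n γ δ 0)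
    (hc0 : c ≠ 0) : δ ≤ hWt c := by
  classical
  by_contra! hlt
  set s : Finset (Fin n) := Finset.univ.filter fun i => c i ≠ 0 with hs
  have hcard : hWt c = s.card := by simp [hWt, hammingNorm, hs]
  let e := s.equivFin
  have hβ : IsPrimitiveRoot (γ ^ 2) n := hγ.pow (by omega) rfl
  have hv : (fun j : Fin s.card => algebraMap F E (c (e.symm j)) * γ ^ ((e.symm j : Fin n) : ℕ)) =
      0 := by
    refine Matrix.eq_zero_of_forall_pow_sum_mul_pow_eq_zero
      (f := fun j : Fin s.card => (γ ^ 2) ^ ((e.symm j : Fin n) : ℕ)) ?_ ?_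
    · intro j k h
      exact e.symm.injective (Subtype.ext (Fin.ext
        (hβ.pow_inj (e.symm j : Fin n).2 (e.symm k : Fin n).2 h)))
    · intro i
      have hi : (i : ℕ) ∈ Finset.Icc 0 (0 + δ - 2) := by
        have := i.2
        simp only [Finset.mem_Icc]
        omega
      simp only [negaBCH, Submodule.mem_iInf, LinearMap.mem_ker] at hc
      have := hc i hi
      rw [evalAt_apply, ← Finset.sum_subset (Finset.subset_univ s), ← Finset.sum_coe_sort,
        ← e.symm.sum_comp] at this
      · rw [← this]
        refine Finset.sum_congr rfl fun j _ => ?_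
        rw [Algebra.smul_def, mul_assoc, ← pow_mul, ← pow_mul, ← pow_mul, ← pow_add]
        congr 2
        ring
      · intro x _ hx
        simp only [hs, Finset.mem_filter, Finset.mem_univ, true_and, not_not] at hx
        simp [hx]
  have hγ0 : γ ≠ 0 := hγ.ne_zero (by omega)
  apply hc0
  ext i
  by_contra hi
  have hmem : i ∈ s := by simpa [hs] using hi
  have := congrFun hv (e ⟨i, hmem⟩)
  simp [hγ0] at this
  exact hi this

end FieldLemmas

section DigitCount

/-- The numbers with at most `k` base-`q` digits, all of them smaller than `b`. -/
def digitsLt (q b k : ℕ) : Finset ℕ :=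
  (Finset.range (q ^ k)).filter fun t => ∀ i < k, t / q ^ i % q < b

lemma mem_digitsLt {q b k t : ℕ} :
    t ∈ digitsLt q b k ↔ t < q ^ k ∧ ∀ i < k, t / q ^ i % q < b := by
  simp [digitsLt]

lemma add_mul_mem_digitsLt {q b k d t : ℕ} (hbq : b ≤ q) (hd : d < b) (ht : t ∈ digitsLt q b k) :
    d + q * t ∈ digitsLt q b (k + 1) := by
  have hdq : d < q := by omega
  have hdiv : (d + q * t) / q = t := by
    rw [Nat.add_mul_div_left _ _ (by omega), Nat.div_eq_of_lt hdq, zero_add]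
  rw [mem_digitsLt] at ht ⊢
  refine ⟨?_, fun i hi => ?_⟩
  · rw [pow_succ']
    nlinarith [ht.1]
  · cases i with
    | zero => simpa [Nat.mod_eq_of_lt hdq] using hd
    | succ i =>
      rw [pow_succ', ← Nat.div_div_eq_div_mul, hdiv]
      exact ht.2 i (by omega)

lemma sum_pow_digitsLt {q b : ℕ} (hbq : b ≤ q) (hq : 0 < q) {ε : ℤ} (hε : ε ^ q = ε) (k : ℕ) :
    ∑ t ∈ digitsLt q b k, ε ^ t = (∑ d ∈ Finset.range b, ε ^ d) ^ k := by
  induction k with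
  | zero =>
    have : digitsLt q b 0 = {0} := by
      ext t
      simp [mem_digitsLt]
    simp [this]
  | succ k ih =>
    rw [pow_succ', ← ih, Finset.sum_mul_sum, ← Finset.sum_product']
    symm
    refine Finset.sum_nbij' (fun x => x.1 + q * x.2) (fun t => (t % q, t / q)) ?_ ?_ ?_ ?_ ?_
    · rintro ⟨d, t⟩ h
      rw [Finset.mem_product, Finset.mem_range] at h
      exact add_mul_mem_digitsLt hbq h.1 h.2
    · intro t ht
      rw [mem_digitsLt] at ht
      rw [Finset.mem_product, Finset.mem_range, mem_digitsLt]
      refine ⟨by simpa using ht.2 0 (by omega), ?_, fun i hi => ?_⟩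
      · rw [Nat.div_lt_iff_lt_mul hq, ← pow_succ]
        exact ht.1
      · have := ht.2 (i + 1) (by omega)
        rwa [pow_succ', ← Nat.div_div_eq_div_mul] at this
    · rintro ⟨d, t⟩ h
      rw [Finset.mem_product, Finset.mem_range] at h
      have hdq : d < q := lt_of_lt_of_le h.1 hbq
      simp [Nat.add_mul_div_left _ _ hq, Nat.div_eq_of_lt hdq, Nat.mod_eq_of_lt hdq]
    · intro t _
      exact Nat.mod_add_div t q
    · rintro ⟨d, t⟩ _
      rw [pow_add, pow_mul, hε]

lemma sum_range_neg_one_pow (b : ℕ) :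
    ∑ d ∈ Finset.range b, (-1 : ℤ) ^ d = ((b + 1) / 2 : ℕ) - (b / 2 : ℕ) := by
  induction b with
  | zero => simp
  | succ b ih =>
    rw [Finset.sum_range_succ, ih]
    rcases Nat.even_or_odd b with h | h
    · rw [h.neg_one_pow]
      obtain ⟨c, rfl⟩ := h
      omega
    · rw [h.neg_one_pow]
      obtain ⟨c, rfl⟩ := h
      omega

lemma sum_range_two_mul (f : ℕ → ℤ) (M : ℕ) :
    ∑ i ∈ Finset.range (2 * M), f i = ∑ j ∈ Finset.range M, (f (2 * j) + f (2 * j + 1)) := by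
  induction M with
  | zero => simp
  | succ M ih =>
    rw [Finset.sum_range_succ, ← ih, show 2 * (M + 1) = 2 * M + 1 + 1 by ring,
      Finset.sum_range_succ, Finset.sum_range_succ, add_assoc]

lemma two_mul_sum_odd_choose (x y : ℤ) {m : ℕ} (hm : 0 < m) :
    2 * ∑ j ∈ Finset.range ((m - 1) / 2 + 1),
      (m.choose (2 * j + 1) : ℤ) * x ^ (2 * j + 1) * y ^ (m - 2 * j - 1) =
      (y + x) ^ m - (y - x) ^ m := by
  set f : ℕ → ℤ := fun i => m.choose i * x ^ i * y ^ (m - i) * (1 - (-1) ^ i) with hf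
  have h1 : (y + x) ^ m - (y - x) ^ m = ∑ i ∈ Finset.range (m + 1), f i := by
    rw [add_comm y x, sub_eq_add_neg y x, add_comm y (-x), add_pow, add_pow,
      ← Finset.sum_sub_distrib]
    refine Finset.sum_congr rfl fun i _ => ?_
    rw [neg_pow x]
    ring
  have h2 : ∑ i ∈ Finset.range (m + 1), f i =
      ∑ i ∈ Finset.range (2 * ((m - 1) / 2 + 1)), f i := by
    rcases Nat.even_or_odd m with h | h
    · rw [Finset.sum_range_succ]
      have : f m = 0 := by simp [hf, h.neg_one_pow]
      rw [this, add_zero]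
      obtain ⟨c, rfl⟩ := h
      congr 2
      omega
    · obtain ⟨c, rfl⟩ := h
      congr 2
      omega
  rw [h1, h2, sum_range_two_mul, Finset.mul_sum]
  refine Finset.sum_congr rfl fun j _ => ?_
  have he : (-1 : ℤ) ^ (2 * j) = 1 := (even_two_mul j).neg_one_pow
  simp only [hf, pow_succ (-1 : ℤ), he, Nat.sub_sub]
  ring

lemma card_filter_odd_digitsLt {q b m : ℕ} (hbq : b ≤ q) (hq : Odd q) (hm : 0 < m) :
    ((digitsLt q b m).filter Odd).card = ∑ j ∈ Finset.range ((m - 1) / 2 + 1),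
      m.choose (2 * j + 1) * (b / 2) ^ (2 * j + 1) * ((b + 1) / 2) ^ (m - 2 * j - 1) := by
  have h1 : 2 * (((digitsLt q b m).filter Odd).card : ℤ) =
      ∑ t ∈ digitsLt q b m, ((1 : ℤ) ^ t - (-1) ^ t) := by
    rw [Finset.card_filter, Nat.cast_sum, Finset.mul_sum]
    refine Finset.sum_congr rfl fun t _ => ?_
    split_ifs with h
    · simp [h.neg_one_pow]
    · simp [(Nat.not_odd_iff_even.1 h).neg_one_pow]
  have hb : ∑ d ∈ Finset.range b, (1 : ℤ) ^ d = ((b + 1) / 2 : ℕ) + (b / 2 : ℕ) := by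
    simp only [one_pow, Finset.sum_const, Finset.card_range, nsmul_eq_mul, mul_one]
    omega
  rw [Finset.sum_sub_distrib, sum_pow_digitsLt hbq hq.pos (one_pow q),
    sum_pow_digitsLt hbq hq.pos hq.neg_one_pow, sum_range_neg_one_pow, hb,
    ← two_mul_sum_odd_choose _ _ hm] at h1
  exact_mod_cast mul_left_cancel₀ two_ne_zero h1

end DigitCount

section CyclicShifts

variable {q m N : ℕ}

lemma modEq_mul_pow_mod (hN : N + 1 = q ^ m) (t j : ℕ) : t * q ^ j ≡ t * q ^ (j % m) [MOD N] := by
  have h1 : q ^ m ≡ 1 [MOD N] := by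
    rw [← hN]
    simp [Nat.ModEq]
  conv_lhs => rw [← Nat.mod_add_div j m, pow_add, pow_mul]
  simpa using ((h1.pow (j / m)).mul_left (q ^ (j % m))).mul_left t

lemma mul_pow_mod_eq (hN : N + 1 = q ^ m) {i j t : ℕ} (hij : i + j + 1 = m) (ht : t < N) :
    (t * q ^ j) % N = t % q ^ (i + 1) * q ^ j + t / q ^ (i + 1) := by
  have hq : 0 < q := by
    rcases Nat.eq_zero_or_pos q with rfl | h
    · rw [zero_pow (by omega)] at hN
      omega
    · exact h
  set v := t % q ^ (i + 1)
  set u := t / q ^ (i + 1)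
  have htuv : v + q ^ (i + 1) * u = t := Nat.mod_add_div _ _
  have hv : v < q ^ (i + 1) := Nat.mod_lt _ (by positivity)
  have hm : q ^ m = q ^ (i + 1) * q ^ j := by rw [← hij, ← pow_add]; congr 1; omega
  have hQ : 0 < q ^ j := by positivity
  have hu : u < q ^ j := by
    by_contra! h
    nlinarith [Nat.mul_le_mul_left (q ^ (i + 1)) h]
  have hlt : v * q ^ j + u < N := by
    rcases Nat.lt_or_ge (v + 1) (q ^ (i + 1)) with h | h
    · have := Nat.mul_le_mul_right (q ^ j) (show v + 2 ≤ q ^ (i + 1) by omega)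
      nlinarith
    · have hv' : v + 1 = q ^ (i + 1) := by omega
      rw [← hv'] at hm htuv
      by_contra! hge
      have hu' : u + 1 = q ^ j := by nlinarith
      rw [← hu'] at hm
      nlinarith
  rw [← Nat.mod_eq_of_lt hlt]
  have : t * q ^ j = v * q ^ j + u + N * u := by
    have : (N + 1) * u = q ^ (i + 1) * q ^ j * u := by rw [hN, hm]
    rw [← htuv]
    linarith
  rw [this, Nat.add_mul_mod_self_left]

lemma mul_pow_mod_lt_iff (hN : N + 1 = q ^ m) (hq : 0 < q) {i j t b : ℕ} (hij : i + j + 1 = m)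
    (ht : t < N) : (t * q ^ j) % N < b * q ^ (m - 1) ↔ t / q ^ i % q < b := by
  have hu : t / q ^ (i + 1) < q ^ j := by
    rw [Nat.div_lt_iff_lt_mul (by positivity), ← pow_add, show j + (i + 1) = m by omega]
    omega
  rw [← Nat.div_lt_iff_lt_mul (by positivity), mul_pow_mod_eq hN hij ht,
    show m - 1 = j + i by omega, pow_add q j i, ← Nat.div_div_eq_div_mul, mul_comm _ (q ^ j),
    Nat.mul_add_div (by positivity), Nat.div_eq_of_lt hu, add_zero, pow_succ,
    Nat.mod_mul_right_div_self]

lemma forall_mul_pow_mod_lt_iff (hN : N + 1 = q ^ m) (hq : 0 < q) (hm : 0 < m) {t b : ℕ}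
    (ht : t < N) :
    (∀ j, (t * q ^ j) % N < b * q ^ (m - 1)) ↔ ∀ i < m, t / q ^ i % q < b := by
  constructor
  · intro h i hi
    rw [← mul_pow_mod_lt_iff hN hq (show i + (m - 1 - i) + 1 = m by omega) ht]
    exact h _
  · intro h j
    have hj := Nat.mod_lt j hm
    rw [modEq_mul_pow_mod hN t j,
      mul_pow_mod_lt_iff hN hq (show (m - 1 - j % m) + j % m + 1 = m by omega) ht]
    exact h _ (by omega)

open Classical in
lemma card_odd_forall_mul_pow_mod_lt (hN : N + 1 = q ^ m) (hq : Odd q) (hm : 0 < m) {b : ℕ}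
    (hbq : b ≤ q) :
    ((Finset.range N).filter fun t => Odd t ∧ ∀ j, (t * q ^ j) % N < b * q ^ (m - 1)).card =
      ∑ j ∈ Finset.range ((m - 1) / 2 + 1),
        m.choose (2 * j + 1) * (b / 2) ^ (2 * j + 1) * ((b + 1) / 2) ^ (m - 2 * j - 1) := by
  rw [← card_filter_odd_digitsLt hbq hq hm]
  congr 1
  ext t
  have hNe : Even N := by
    have := hq.pow (n := m)
    rw [← hN] at this
    simpa [Nat.odd_add_one] using this
  simp only [Finset.mem_filter, Finset.mem_range, mem_digitsLt, ← hN]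
  constructor
  · rintro ⟨h1, h2, h3⟩
    exact ⟨⟨by omega, (forall_mul_pow_mod_lt_iff hN hq.pos hm h1).1 h3⟩, h2⟩
  · rintro ⟨⟨h1, h3⟩, h2⟩
    have h1' : t < N := by
      rcases (Nat.lt_succ_iff.1 h1).lt_or_eq with h | rfl
      · exact h
      · exact absurd hNe (Nat.not_even_iff_odd.2 h2)
    exact ⟨h1', h2, (forall_mul_pow_mod_lt_iff hN hq.pos hm h1').2 h3⟩

open Classical in
lemma card_odd_forall_mul_pow_mod_le (hN : N + 1 = q ^ m) (hq : Odd q) (hq1 : 1 < q) (hm : 0 < m)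
    {b : ℕ} (hb : Odd b) (hbN : b * q ^ (m - 1) < N) :
    ((Finset.range N).filter fun t => Odd t ∧ ∀ j, (t * q ^ j) % N ≤ b * q ^ (m - 1)).card =
      ((Finset.range N).filter fun t => Odd t ∧ ∀ j, (t * q ^ j) % N < b * q ^ (m - 1)).card
        + m := by
  have hle : ∀ i < m, b * q ^ i ≤ b * q ^ (m - 1) := fun i hi =>
    Nat.mul_le_mul_left b (Nat.pow_le_pow_right hq.pos (by omega))
  have hinj : Function.Injective fun i => b * q ^ i := fun i j h =>
    Nat.pow_right_injective hq1 (Nat.eq_of_mul_eq_mul_left hb.pos h)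
  have hcard : ((Finset.range m).image fun i => b * q ^ i).card = m := by
    rw [Finset.card_image_of_injective _ hinj, Finset.card_range]
  refine Eq.trans ?_ (congrArg (_ + ·) hcard)
  rw [← Finset.card_union_of_disjoint]
  · congr 1
    ext t
    simp only [Finset.mem_union, Finset.mem_filter, Finset.mem_range, Finset.mem_image]
    constructor
    · rintro ⟨ht, hodd, h⟩
      by_cases hlt : ∀ j, (t * q ^ j) % N < b * q ^ (m - 1)
      · exact Or.inl ⟨ht, hodd, hlt⟩
      · push Not at hlt
        obtain ⟨j, hj⟩ := hlt
        have hj' : (t * q ^ j) % N = b * q ^ (m - 1) := le_antisymm (h j) hj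
        set i := (m - 1 + (m - 1) * j) % m with hi
        have him : i < m := Nat.mod_lt _ hm
        refine Or.inr ⟨i, him, ?_⟩
        have e1 : t * q ^ j ≡ b * q ^ (m - 1) [MOD N] := by
          rw [← hj']
          exact (Nat.mod_modEq _ _).symm
        have e2 := e1.mul_right (q ^ ((m - 1) * j))
        rw [mul_assoc, mul_assoc, ← pow_add, ← pow_add] at e2
        have e3 := (modEq_mul_pow_mod hN t (j + (m - 1) * j)).symm.trans
          (e2.trans (modEq_mul_pow_mod hN b _))
        rw [show j + (m - 1) * j = m * j by
          obtain ⟨c, rfl⟩ := Nat.exists_eq_succ_of_ne_zero hm.ne'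
          simp
          ring, Nat.mul_mod_right, pow_zero, mul_one] at e3
        exact (e3.eq_of_lt_of_lt ht ((hle i him).trans_lt hbN)).symm
    · rintro (⟨ht, hodd, h⟩ | ⟨i, hi, rfl⟩)
      · exact ⟨ht, hodd, fun j => (h j).le⟩
      · refine ⟨(hle i hi).trans_lt hbN, hb.mul hq.pow, fun j => ?_⟩
        have hk := Nat.mod_lt (i + j) hm
        rw [mul_assoc, ← pow_add, modEq_mul_pow_mod hN b (i + j),
          Nat.mod_eq_of_lt ((hle _ hk).trans_lt hbN)]
        exact hle _ hk
  · rw [Finset.disjoint_left]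
    intro t ht ht'
    simp only [Finset.mem_filter, Finset.mem_image, Finset.mem_range] at ht ht'
    obtain ⟨i, hi, rfl⟩ := ht'
    have := ht.2.2 (m - 1 - i)
    rw [mul_assoc, ← pow_add, show i + (m - 1 - i) = m - 1 by omega, Nat.mod_eq_of_lt hbN] at this
    exact lt_irrefl _ this

end CyclicShifts

lemma card_filter_odd_range_two_mul (n : ℕ) : ((Finset.range (2 * n)).filter Odd).card = n := by
  induction n with
  | zero => simp
  | succ n ih =>
    rw [show 2 * (n + 1) = 2 * n + 1 + 1 by ring, Finset.range_add_one, Finset.range_add_one,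
      Finset.filter_insert, Finset.filter_insert, if_pos (odd_two_mul_add_one n),
      if_neg (by simp), Finset.card_insert_of_notMem (by simp), ih]

section Dimension

variable {F E : Type*} [Field F] [Fintype F] [Field E] [Algebra F E]

open Classical in
lemma finrank_negaBCH {q m n δ B : ℕ} (hF : Fintype.card F = q) (hN : 2 * n + 1 = q ^ m)
    (hq : Odd q) (hm : 0 < m) (hδ : 2 ≤ δ) (hB : B + 2 * δ = 2 * n + 1)
    {γ : E} (hγ : IsPrimitiveRoot γ (2 * n)) :
    Module.finrank F (negaBCH F n γ δ 0) =
      ((Finset.range (2 * n)).filter fun t => Odd t ∧ ∀ j, (t * q ^ j) % (2 * n) ≤ B).card := by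
  have hn : 0 < n := by omega
  have hζ := hγ.inv
  set ζ := γ⁻¹ with hζdef
  set T := (Finset.range (2 * n)).filter fun t => Odd t ∧ ∃ j, B < (t * q ^ j) % (2 * n) with hT
  set S := T.image fun t => ζ ^ t with hS
  have hmod : ∀ r, ζ ^ (r % (2 * n)) = ζ ^ r := fun r => by
    rw [hζ.eq_orderOf, pow_mod_orderOf]
  have hoddmod : ∀ r, Odd r → Odd (r % (2 * n)) := fun r hr => by
    rw [Nat.odd_iff] at hr ⊢
    rwa [Nat.mod_mul_right_mod]
  have hcardS : S.card = T.card := by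
    refine Finset.card_image_of_injOn fun s hs t ht h => ?_
    simp only [hT, Finset.coe_filter, Finset.mem_range, Set.mem_ofPred_eq] at hs ht
    exact hζ.pow_inj hs.1 ht.1 h
  have hcardT : T.card + ((Finset.range (2 * n)).filter fun t =>
      Odd t ∧ ∀ j, (t * q ^ j) % (2 * n) ≤ B).card = n := by
    conv_rhs => rw [← card_filter_odd_range_two_mul n]
    rw [← Finset.card_filter_add_card_filter_not
      (s := (Finset.range (2 * n)).filter Odd) (fun t => ∃ j, B < (t * q ^ j) % (2 * n)),
      Finset.filter_filter, Finset.filter_filter]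
    simp only [not_exists, not_lt, hT]
  have hSq : ∀ x ∈ S, x ^ Fintype.card F ∈ S := by
    intro x hx
    obtain ⟨t, ht, rfl⟩ := Finset.mem_image.1 hx
    simp only [hT, Finset.mem_filter, Finset.mem_range] at ht
    obtain ⟨-, hodd, j, hj⟩ := ht
    refine Finset.mem_image.2 ⟨(t * q) % (2 * n), ?_, ?_⟩
    · simp only [hT, Finset.mem_filter, Finset.mem_range]
      refine ⟨Nat.mod_lt _ (by omega), hoddmod _ (hodd.mul hq), j + (m - 1), ?_⟩
      have h1 : (t * q) % (2 * n) * q ^ (j + (m - 1)) ≡ t * q * q ^ (j + (m - 1)) [MOD 2 * n] :=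
        (Nat.mod_modEq _ _).mul_right _
      rw [mul_assoc, ← pow_succ', show j + (m - 1) + 1 = j + m by omega] at h1
      have h2 := modEq_mul_pow_mod hN t (j + m)
      rw [Nat.add_mod_right] at h2
      replace h2 := h2.trans (modEq_mul_pow_mod hN t j).symm
      rw [h1.trans h2]
      exact hj
    · rw [hF, ← pow_mul]
      exact hmod _
  have hcode : negaBCH F n γ δ 0 = ⨅ x ∈ S, LinearMap.ker (evalAt F n x) := by
    have hflip : ∀ r i : ℕ, r + (1 + 2 * i) = 2 * n → ζ ^ r = γ ^ (1 + 2 * i) := by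
      intro r i h
      have h1 : γ ^ r * γ ^ (1 + 2 * i) = 1 := by rw [← pow_add, h, hγ.pow_eq_one]
      rw [hζdef, inv_pow]
      exact inv_eq_of_mul_eq_one_right h1
    ext c
    simp only [negaBCH, Submodule.mem_iInf, LinearMap.mem_ker, Finset.mem_Icc]
    constructor
    · intro h x hx
      obtain ⟨t, ht, rfl⟩ := Finset.mem_image.1 hx
      simp only [hT, Finset.mem_filter, Finset.mem_range] at ht
      obtain ⟨-, hodd, j, hj⟩ := ht
      have hr := Nat.mod_lt (t * q ^ j) (show 0 < 2 * n by omega)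
      obtain ⟨s, hs⟩ := hoddmod _ (hodd.mul (hq.pow (n := j)))
      have h0 := h (n - s - 1) (by omega)
      rw [← hflip ((t * q ^ j) % (2 * n)) (n - s - 1) (by omega), hmod, pow_mul, ← hF,
        evalAt_pow_card_pow] at h0
      exact eq_zero_of_pow_eq_zero h0
    · intro h i hi
      rw [← hflip (2 * n - 1 - 2 * i) i (by omega)]
      refine h _ (Finset.mem_image_of_mem _ ?_)
      simp only [hT, Finset.mem_filter, Finset.mem_range]
      refine ⟨by omega, ⟨n - 1 - i, by omega⟩, 0, ?_⟩
      rw [pow_zero, mul_one, Nat.mod_eq_of_lt (by omega)]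
      omega
  rw [hcode, finrank_iInf_ker_evalAt S hSq (by omega)]
  omega

end Dimension

theorem stmt_1 (q m a n δt' δ k : ℕ)
    (hq : ∃ p e : ℕ, p.Prime ∧ Odd p ∧ 0 < e ∧ q = p ^ e)
    (hq3 : 3 < q) (hm : 2 < m)
    (ha1 : 1 ≤ a) (ha2 : 2 * a < q - 1)
    (hn : 2 * n = q ^ m - 1)
    (hδt : δt' = a * q ^ (m - 1) - 1)
    (hδ : δ = (δt' + 2) / 2)
    (hk : k = (∑ j ∈ Finset.range ((m - 1) / 2 + 1),
      Nat.choose m (2 * j + 1) * ((q - a) / 2) ^ (2 * j + 1) *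
        ((q - a + 1) / 2) ^ (m - 2 * j - 1)) + (if Even a then 1 else 0) * m)
    (F E : Type*) [Field F] [Fintype F] [Field E] [Algebra F E]
    (hF : Fintype.card F = q)
    (γ : E) (hγ : IsPrimitiveRoot γ (2 * n)) :
    (∀ c ∈ negaBCH F n γ δ 0, c ≠ 0 → δ ≤ hWt c) ∧
    Module.finrank F (negaBCH F n γ δ 0) = k := by
  classical
  have hqodd : Odd q := by
    obtain ⟨p, e, -, hp, -, rfl⟩ := hq
    exact hp.pow
  have hm0 : 0 < m := by omega
  have hN : 2 * n + 1 = q ^ m := by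
    have := Nat.pow_pos (n := m) (show 0 < q by omega)
    omega
  set Q := q ^ (m - 1) with hQ
  have hQodd : Odd Q := hqodd.pow
  have hQq : q ^ m = q * Q := by rw [hQ, ← pow_succ']; congr 1; omega
  have hQ4 : 4 ≤ Q := by
    have := Nat.pow_le_pow_right (show 0 < q by omega) (show 1 ≤ m - 1 by omega)
    rw [pow_one] at this
    omega
  have haQ : 4 ≤ a * Q := by nlinarith
  obtain ⟨b, hb⟩ : ∃ b, q = a + b := ⟨q - a, by omega⟩
  have hsum : a * Q + b * Q = 2 * n + 1 := by rw [hN, hQq, hb]; ring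
  have hbN : b * Q < 2 * n := by omega
  have hbq : b ≤ q := by omega
  have hqa : q - a = b := by omega
  have hδ2 : 2 ≤ δ := by omega
  have hn0 : n ≠ 0 := by omega
  refine ⟨fun c hc hc0 => le_hWt_of_mem_negaBCH hn0 hδ2 hγ hc hc0, ?_⟩
  rw [hk, hqa]
  by_cases ha : Even a
  · have hbodd : Odd b := by
      rw [hb, Nat.odd_add] at hqodd
      by_contra h
      exact Nat.not_odd_iff_even.2 ha (hqodd.2 (Nat.not_odd_iff_even.1 h))
    obtain ⟨c, hc⟩ := ha.mul_right Q
    rw [finrank_negaBCH hF hN hqodd hm0 hδ2 (B := b * Q) (by omega) hγ,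
      card_odd_forall_mul_pow_mod_le hN hqodd (by omega) hm0 hbodd hbN,
      card_odd_forall_mul_pow_mod_lt hN hqodd hm0 hbq, if_pos ha, one_mul]
  · obtain ⟨c, hc⟩ := (Nat.not_even_iff_odd.1 ha).mul hQodd
    have hbQ : 0 < b * Q := by
      have : 0 < b := by omega
      positivity
    rw [finrank_negaBCH hF hN hqodd hm0 hδ2 (B := b * Q - 1) (by omega) hγ, if_neg ha, zero_mul,
      add_zero, ← card_odd_forall_mul_pow_mod_lt hN hqodd hm0 hbq]
    simp only [← hQ, Nat.le_sub_one_iff_lt hbQ]
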